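/- arXiv:2509.14192 — 5 statements merged into one kernel-verified Lean document; each statement's English description precedes it below -/
import Mathlib

section
/- Let z lie in the open upper half-plane and, for t ≥ 0, define the characteristic z_t := z·cosh(t/2) + (z + 2·m_sc(z))·sinh(t/2). Then for every t ≥ 0 the point z_t lies in the open upper half-plane, m_sc(z_t) = e^{−t/2}·m_sc(z), and the map t ↦ z_t is differentiable with d/dt z_t = m_sc(z_t) + z_t/2. -/
open Real MeasureTheory

/-- The semicircle density. -/
noncomputable def ρsc (E : ℝ) : ℝ := if |E| ≤ 2 then Real.sqrt (4 - E ^ 2) / (2 * Real.pi) else 0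

/-- The Stieltjes transform of the semicircle density. -/
noncomputable def msc (z : ℂ) : ℂ := ∫ x : ℝ, (ρsc x : ℂ) / ((x : ℂ) - z)

/-- The characteristic started at `z`. -/
noncomputable def charz (z : ℂ) (t : ℝ) : ℂ :=
  z * (Real.cosh (t / 2) : ℂ) + (z + 2 * msc z) * (Real.sinh (t / 2) : ℂ)

theorem circleMap_zero_one_eq (θ : ℝ) :
    circleMap 0 1 θ = (Real.cos θ : ℂ) + (Real.sin θ : ℂ) * Complex.I := by
  simp [circleMap, Complex.exp_mul_I]

/-- The mean value property on the unit circle, with the circle folded onto its upper half. -/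
theorem integral_circleMap_add_circleMap_neg {H : ℂ → ℂ}
    (hH : DifferentiableOn ℂ H (Metric.closedBall 0 1)) :
    ∫ θ in (0 : ℝ)..π, (H (circleMap 0 1 θ) + H (circleMap 0 1 (-θ))) = 2 * π * H 0 := by
  have hcont : Continuous fun θ : ℝ => H (circleMap 0 1 θ) :=
    hH.continuousOn.comp_continuous (continuous_circleMap 0 1)
      fun θ => circleMap_mem_closedBall 0 zero_le_one θ
  have hmean : circleAverage H 0 1 = H 0 := by
    apply DiffContOnCl.circleAverage
    apply DifferentiableOn.diffContOnCl
    rw [abs_one, closure_ball _ one_ne_zero]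
    exact hH
  have hper : Function.Periodic (fun θ : ℝ => H (circleMap 0 1 θ)) (2 * π) := fun θ => by
    simp only [periodic_circleMap 0 1 θ]
  have hshift := hper.intervalIntegral_add_eq 0 (-π)
  rw [zero_add, show -π + 2 * π = π by ring] at hshift
  have hfold : ∫ θ in (0 : ℝ)..π, H (circleMap 0 1 (-θ))
      = ∫ θ in (-π)..0, H (circleMap 0 1 θ) := by
    simpa using intervalIntegral.integral_comp_neg (a := 0) (b := π)
      fun θ : ℝ => H (circleMap 0 1 θ)
  have hneg : Continuous fun θ : ℝ => H (circleMap 0 1 (-θ)) := hcont.comp continuous_neg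
  rw [intervalIntegral.integral_add (hcont.intervalIntegrable _ _)
    (hneg.intervalIntegrable _ _), hfold, add_comm,
    intervalIntegral.integral_add_adjacent_intervals (hcont.intervalIntegrable _ _)
    (hcont.intervalIntegrable _ _), ← hshift, ← hmean, circleAverage, Complex.real_smul]
  push_cast
  have : (π : ℂ) ≠ 0 := by exact_mod_cast Real.pi_ne_zero
  field_simp

theorem ofReal_sub_ne_zero_of_im_pos {z : ℂ} (hz : 0 < z.im) (x : ℝ) : (x : ℂ) - z ≠ 0 := by
  intro h
  have := congrArg Complex.im h
  simp at this
  linarith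

/-- The substitution `x = 2 cos θ` in the Stieltjes transform. -/
theorem msc_eq_integral_sin_sq {z : ℂ} (hz : 0 < z.im) :
    msc z = ∫ θ in (0 : ℝ)..π,
      (2 * (Real.sin θ : ℂ) ^ 2 / π) / (2 * (Real.cos θ : ℂ) - z) := by
  set g : ℝ → ℂ := fun x => ((√(4 - x ^ 2) / (2 * π) : ℝ) : ℂ) / ((x : ℂ) - z) with hg
  have hgc : Continuous g := by
    apply Continuous.div
    · fun_prop
    · fun_prop
    · exact ofReal_sub_ne_zero_of_im_pos hz
  have hind : (fun x : ℝ => (ρsc x : ℂ) / ((x : ℂ) - z)) = (Set.Icc (-2) 2).indicator g := by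
    ext x
    by_cases hx : |x| ≤ 2
    · rw [Set.indicator_of_mem (by simpa [abs_le] using hx)]
      simp [hg, ρsc, hx]
    · rw [Set.indicator_of_notMem (by simpa [abs_le] using hx)]
      simp [ρsc, hx]
  have hsub := intervalIntegral.integral_deriv_smul_comp (a := π) (b := 0)
    (f := fun θ => 2 * Real.cos θ) (f' := fun θ => 2 * -Real.sin θ) (g := g)
    (fun θ _ => (Real.hasDerivAt_cos θ).const_mul 2) (by fun_prop) hgc
  simp only [Real.cos_pi, Real.cos_zero, mul_one, mul_neg] at hsub
  rw [msc, hind, integral_indicator measurableSet_Icc, integral_Icc_eq_integral_Ioc,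
    ← intervalIntegral.integral_of_le (by norm_num), ← hsub, intervalIntegral.integral_symm,
    ← intervalIntegral.integral_neg]
  apply intervalIntegral.integral_congr
  intro θ hθ
  rw [Set.uIcc_of_le Real.pi_pos.le] at hθ
  have hsin : √(4 - (2 * Real.cos θ) ^ 2) = 2 * Real.sin θ := by
    rw [show 4 - (2 * Real.cos θ) ^ 2 = (2 * Real.sin θ) ^ 2 by
      nlinarith [Real.sin_sq_add_cos_sq θ]]
    exact Real.sqrt_sq (by linarith [Real.sin_nonneg_of_nonneg_of_le_pi hθ.1 hθ.2])
  have hne := ofReal_sub_ne_zero_of_im_pos hz (2 * Real.cos θ)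
  have hpi : (π : ℂ) ≠ 0 := by exact_mod_cast Real.pi_ne_zero
  simp only [hg, Function.comp_apply, hsin, Complex.real_smul]
  push_cast at hne ⊢
  field_simp

/-- The Stieltjes transform of the semicircle law is the root of `w² + z w + 1 = 0` in the unit
disc. -/
theorem msc_eq_of_quadratic {z w : ℂ} (hz : 0 < z.im) (hw : w ^ 2 + z * w + 1 = 0)
    (hn : ‖w‖ < 1) : msc z = w := by
  have hden : ∀ u ∈ Metric.closedBall (0 : ℂ) 1, 1 + w * u ≠ 0 := by
    intro u hu h
    rw [mem_closedBall_zero_iff] at hu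
    have h1 : ‖w * u‖ = 1 := by rw [eq_neg_of_add_eq_zero_right h]; simp
    rw [norm_mul] at h1
    nlinarith [norm_nonneg w, norm_nonneg u]
  have hmean := integral_circleMap_add_circleMap_neg (H := fun u => (1 - u ^ 2) / (1 + w * u))
    (DifferentiableOn.div (by fun_prop) (by fun_prop) hden)
  have hpi : (π : ℂ) ≠ 0 := by exact_mod_cast Real.pi_ne_zero
  rw [msc_eq_integral_sin_sq hz]
  have hint : ∀ θ : ℝ, (2 * (Real.sin θ : ℂ) ^ 2 / π) / (2 * (Real.cos θ : ℂ) - z)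
      = w / (2 * π) * ((1 - circleMap 0 1 θ ^ 2) / (1 + w * circleMap 0 1 θ)
        + (1 - circleMap 0 1 (-θ) ^ 2) / (1 + w * circleMap 0 1 (-θ))) := by
    intro θ
    have h1 := hden _ (circleMap_mem_closedBall 0 zero_le_one θ)
    have h2 := hden _ (circleMap_mem_closedBall 0 zero_le_one (-θ))
    have h3 := ofReal_sub_ne_zero_of_im_pos hz (2 * Real.cos θ)
    have hsc : (Real.sin θ : ℂ) ^ 2 + (Real.cos θ : ℂ) ^ 2 = 1 := by
      exact_mod_cast Real.sin_sq_add_cos_sq θ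
    simp only [circleMap_zero_one_eq, Real.cos_neg, Real.sin_neg] at h1 h2 ⊢
    push_cast at h1 h2 h3 hsc ⊢
    generalize Complex.sin θ = s at *
    generalize Complex.cos θ = c at *
    have hI := Complex.I_sq
    have hprod : (1 + w * (c + s * Complex.I)) * (1 + w * (c + -s * Complex.I))
        = w * (2 * c - z) := by
      linear_combination w ^ 2 * hsc - w ^ 2 * s ^ 2 * hI + hw
    have hnum : (1 - (c + s * Complex.I) ^ 2) * (1 + w * (c + -s * Complex.I))
        + (1 + w * (c + s * Complex.I)) * (1 - (c + -s * Complex.I) ^ 2) = 4 * s ^ 2 := by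
      linear_combination (-2 * s ^ 2 + 2 * w * c * s ^ 2) * hI
        + (-2 - 2 * w * c) * hsc
    have hw0 : w ≠ 0 := by
      rintro rfl
      simp at hw
    rw [div_add_div _ _ h1 h2, hnum, hprod]
    field_simp
    ring
  simp_rw [hint]
  rw [intervalIntegral.integral_const_mul, hmean]
  field_simp
  simp

theorem neg_add_inv_im (w : ℂ) : (-(w + w⁻¹)).im = w.im * ((Complex.normSq w)⁻¹ - 1) := by
  simp [Complex.inv_im]
  ring

theorem neg_add_inv_im_pos {w : ℂ} (hw : 0 < w.im) (hn : ‖w‖ < 1) : 0 < (-(w + w⁻¹)).im := by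
  have hw0 : w ≠ 0 := by
    rintro rfl
    simp at hw
  rw [neg_add_inv_im]
  refine mul_pos hw (sub_pos.2 ((one_lt_inv₀ (Complex.normSq_pos.2 hw0)).2 ?_))
  rw [Complex.normSq_eq_norm_sq]
  nlinarith [norm_nonneg w]

theorem msc_neg_add_inv {w : ℂ} (hw : 0 < w.im) (hn : ‖w‖ < 1) : msc (-(w + w⁻¹)) = w := by
  have hw0 : w ≠ 0 := by
    rintro rfl
    simp at hw
  refine msc_eq_of_quadratic (neg_add_inv_im_pos hw hn) ?_ hn
  field_simp
  ring

/-- The Joukowski map `w ↦ -(w + 1/w)` sends the upper half of the unit disc onto the upper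
half-plane. -/
theorem exists_eq_neg_add_inv {z : ℂ} (hz : 0 < z.im) :
    ∃ w : ℂ, 0 < w.im ∧ ‖w‖ < 1 ∧ z = -(w + w⁻¹) := by
  obtain ⟨d, hd⟩ := IsAlgClosed.exists_pow_nat_eq (z ^ 2 - 4) (n := 2) two_pos
  obtain ⟨v, hv0, hzv⟩ : ∃ v : ℂ, v ≠ 0 ∧ z = -(v + v⁻¹) := by
    have h : (-z + d) / 2 * ((-z - d) / 2) = 1 := by linear_combination -hd / 4
    refine ⟨(-z + d) / 2, left_ne_zero_of_mul_eq_one h, ?_⟩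
    rw [inv_eq_of_mul_eq_one_right h]
    ring
  obtain ⟨w, hw0, hwn, hzw⟩ : ∃ w : ℂ, w ≠ 0 ∧ ‖w‖ ≤ 1 ∧ z = -(w + w⁻¹) := by
    rcases le_total ‖v‖ 1 with h | h
    · exact ⟨v, hv0, h, hzv⟩
    · refine ⟨v⁻¹, inv_ne_zero hv0, ?_, by rw [hzv, inv_inv, add_comm]⟩
      rw [norm_inv]
      exact inv_le_one_of_one_le₀ h
  have him : 0 < w.im * ((Complex.normSq w)⁻¹ - 1) := by rwa [← neg_add_inv_im, ← hzw]
  have hlt : ‖w‖ < 1 := by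
    refine lt_of_le_of_ne hwn fun h => ?_
    simp [Complex.normSq_eq_norm_sq, h] at him
  have hnn : 0 ≤ (Complex.normSq w)⁻¹ - 1 := by
    refine sub_nonneg.2 ((one_le_inv₀ (Complex.normSq_pos.2 hw0)).2 ?_)
    rw [Complex.normSq_eq_norm_sq]
    nlinarith [norm_nonneg w]
  exact ⟨w, pos_of_mul_pos_left him hnn, hlt, hzw⟩

theorem charz_neg_add_inv {w : ℂ} (hw : 0 < w.im) (hn : ‖w‖ < 1) (t : ℝ) :
    charz (-(w + w⁻¹)) t
      = -((Real.exp (-t / 2) : ℂ) * w + ((Real.exp (-t / 2) : ℂ) * w)⁻¹) := by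
  rw [charz, msc_neg_add_inv hw hn, Real.cosh_eq, Real.sinh_eq, mul_inv, ← Complex.ofReal_inv,
    ← Real.exp_neg, show -(-t / 2) = t / 2 by ring, show -t / 2 = -(t / 2) by ring]
  push_cast
  ring

theorem hasDerivAt_charz (z : ℂ) (t : ℝ) :
    HasDerivAt (fun s : ℝ => charz z s)
      ((Real.exp (-t / 2) : ℂ) * msc z + charz z t / 2) t := by
  have hhalf : HasDerivAt (fun s : ℝ => s / 2) (1 / 2) t := (hasDerivAt_id t).div_const 2
  have h := (hhalf.cosh.ofReal_comp.const_mul z).add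
    (hhalf.sinh.ofReal_comp.const_mul (z + 2 * msc z))
  refine h.congr_deriv ?_
  have hexp : Real.exp (-t / 2) = Real.cosh (t / 2) - Real.sinh (t / 2) := by
    rw [Real.cosh_sub_sinh]
    ring_nf
  rw [charz, hexp]
  push_cast
  ring

/-- The characteristic stays in the upper half-plane, `m_sc` decays exponentially along it, and
it solves the characteristic ODE `ż_t = m_sc(z_t) + z_t/2`. -/
theorem characteristics_basic (z : ℂ) (hz : 0 < z.im) (t : ℝ) (ht : 0 ≤ t) :
    0 < (charz z t).im ∧
      msc (charz z t) = (Real.exp (-t / 2) : ℂ) * msc z ∧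
      HasDerivAt (fun s : ℝ => charz z s) (msc (charz z t) + charz z t / 2) t := by
  obtain ⟨w, hw, hn, rfl⟩ := exists_eq_neg_add_inv hz
  have hpos : 0 < ((Real.exp (-t / 2) : ℂ) * w).im := by
    rw [Complex.im_ofReal_mul]
    exact mul_pos (Real.exp_pos _) hw
  have hlt : ‖(Real.exp (-t / 2) : ℂ) * w‖ < 1 := by
    rw [norm_mul, Complex.norm_real, Real.norm_of_nonneg (Real.exp_pos _).le]
    exact mul_lt_one_of_nonneg_of_lt_one_right (Real.exp_le_one_iff.2 (by linarith))
      (norm_nonneg w) hn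
  have hm : msc (charz (-(w + w⁻¹)) t) = (Real.exp (-t / 2) : ℂ) * msc (-(w + w⁻¹)) := by
    rw [charz_neg_add_inv hw hn, msc_neg_add_inv hpos hlt, msc_neg_add_inv hw hn]
  refine ⟨?_, hm, ?_⟩
  · rw [charz_neg_add_inv hw hn]
    exact neg_add_inv_im_pos hpos hlt
  · rw [hm]
    exact hasDerivAt_charz _ t
end

section
/- There exists a constant C > 0 such that for every integer N ≥ 2, all indices 1 ≤ j, k ≤ N and all t ∈ [0,1]: C⁻¹·(|γ_j − γ_k| + t² + t·ρ_k) ≤ |cosh(t/2)·γ_k − γ_j| + t·ρ_k ≤ C·(|γ_j − γ_k| + t² + t·ρ_k). -/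
open Real MeasureTheory

/-- `γ` is the family of classical locations (quantiles) of the semicircle law for an
`N`-point ensemble: `∫_{γ_i}^2 ρ_sc = (i - 1/2)/N` with `γ_i ∈ (-2,2)`. -/
def IsQuantile (N : ℕ) (γ : ℕ → ℝ) : Prop :=
  ∀ i : ℕ, 1 ≤ i → i ≤ N →
    γ i ∈ Set.Ioo (-2 : ℝ) 2 ∧ (∫ x in (γ i)..(2 : ℝ), ρsc x) = ((i : ℝ) - 1 / 2) / N

theorem one_add_sq_div_eight_le_cosh_half (t : ℝ) : 1 + t ^ 2 / 8 ≤ Real.cosh (t / 2) := by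
  have hsinh : (t / 4) ^ 2 ≤ Real.sinh (t / 4) ^ 2 :=
    sq_le_sq.mpr (by rw [Real.abs_sinh]; exact Real.self_le_sinh_iff.mpr (abs_nonneg _))
  have hcosh : Real.cosh (t / 2) = 1 + 2 * Real.sinh (t / 4) ^ 2 := by
    rw [show t / 2 = 2 * (t / 4) by ring, Real.cosh_two_mul, Real.cosh_sq]
    ring
  rw [hcosh]
  linarith

theorem cosh_half_le_one_add_sq_div_four {t : ℝ} (ht : t ∈ Set.Icc (0 : ℝ) 1) :
    Real.cosh (t / 2) ≤ 1 + t ^ 2 / 4 := by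
  have hexp := Real.cosh_le_exp_half_sq (t / 2)
  have hsq : t ^ 2 ≤ 1 := pow_le_one₀ ht.1 ht.2
  have hy : 0 ≤ (t / 2) ^ 2 / 2 := by positivity
  have habs := Real.abs_exp_sub_one_le (x := (t / 2) ^ 2 / 2) (by rw [abs_of_nonneg hy]; linarith)
  rw [abs_of_nonneg hy] at habs
  linarith [le_abs_self (Real.exp ((t / 2) ^ 2 / 2) - 1)]

/-- The upper comparison, for `a ∈ [-2, 2]` and arbitrary `b`. -/
theorem abs_cosh_mul_sub_le {a b t : ℝ} (ha : |a| ≤ 2) (ht : t ∈ Set.Icc (0 : ℝ) 1) :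
    |Real.cosh (t / 2) * a - b| ≤ |b - a| + t ^ 2 / 2 := by
  have hlo := Real.one_le_cosh (t / 2)
  have hhi := cosh_half_le_one_add_sq_div_four ht
  calc |Real.cosh (t / 2) * a - b| = |(a - b) + (Real.cosh (t / 2) - 1) * a| := by ring_nf
    _ ≤ |a - b| + |(Real.cosh (t / 2) - 1) * a| := abs_add_le _ _
    _ = |b - a| + (Real.cosh (t / 2) - 1) * |a| := by
      rw [abs_sub_comm, abs_mul, abs_of_nonneg (sub_nonneg.mpr hlo)]
    _ ≤ |b - a| + t ^ 2 / 4 * 2 := by gcongr; linarith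
    _ = |b - a| + t ^ 2 / 2 := by ring

theorem abs_sub_le_abs_cosh_mul_sub {a b t : ℝ} (ha : |a| ≤ 2) (ht : t ∈ Set.Icc (0 : ℝ) 1) :
    |b - a| ≤ |Real.cosh (t / 2) * a - b| + t ^ 2 / 2 := by
  have hlo := Real.one_le_cosh (t / 2)
  have hhi := cosh_half_le_one_add_sq_div_four ht
  calc |b - a| = |(Real.cosh (t / 2) - 1) * a - (Real.cosh (t / 2) * a - b)| := by ring_nf
    _ ≤ |(Real.cosh (t / 2) - 1) * a| + |Real.cosh (t / 2) * a - b| := abs_sub _ _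
    _ = |Real.cosh (t / 2) * a - b| + (Real.cosh (t / 2) - 1) * |a| := by
      rw [abs_mul, abs_of_nonneg (sub_nonneg.mpr hlo), add_comm]
    _ ≤ |Real.cosh (t / 2) * a - b| + t ^ 2 / 4 * 2 := by gcongr; linarith
    _ = |Real.cosh (t / 2) * a - b| + t ^ 2 / 2 := by ring

/-- Near the edge, multiplication by `cosh (t / 2)` pushes `a` past the edge by order `t ^ 2`, so
away from every `b ≤ 2`. -/
theorem abs_sub_add_sq_le_of_sqrt_le {a b t : ℝ} (ha : a ∈ Set.Icc (0 : ℝ) 2) (hb : b ≤ 2)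
    (ht : t ∈ Set.Icc (0 : ℝ) 1) (hρ : Real.sqrt (4 - a ^ 2) ≤ t / 4) :
    |b - a| + t ^ 2 / 16 ≤ |Real.cosh (t / 2) * a - b| := by
  obtain ⟨ha0, ha2⟩ := ha
  have hsq : t ^ 2 ≤ 1 := pow_le_one₀ ht.1 ht.2
  have hρ2 : 4 - a ^ 2 ≤ (t / 4) ^ 2 := (Real.sqrt_le_left (by linarith [ht.1])).mp hρ
  have hedge : 2 - a ≤ t ^ 2 / 32 := by nlinarith [mul_nonneg ha0 (sub_nonneg.mpr ha2)]
  have hlo := one_add_sq_div_eight_le_cosh_half t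
  have hshift : t ^ 2 / 8 ≤ (Real.cosh (t / 2) - 1) * a := by nlinarith [sq_nonneg t]
  have habs : |b - a| ≤ a - b + t ^ 2 / 16 := abs_le.mpr ⟨by linarith [sq_nonneg t], by linarith⟩
  linarith [le_abs_self (Real.cosh (t / 2) * a - b)]

/-- The lower comparison holds for all points of `[-2, 2]`. -/
theorem abs_sub_add_sq_add_le {a b t : ℝ} (ha : |a| ≤ 2) (hb : |b| ≤ 2)
    (ht : t ∈ Set.Icc (0 : ℝ) 1) :
    |b - a| + t ^ 2 + t * Real.sqrt (4 - a ^ 2) ≤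
      16 * (|Real.cosh (t / 2) * a - b| + t * Real.sqrt (4 - a ^ 2)) := by
  wlog ha0 : 0 ≤ a generalizing a b
  · have h := this (a := -a) (b := -b) (by rwa [abs_neg]) (by rwa [abs_neg]) (by linarith)
    rwa [neg_sq, neg_sub_neg, mul_neg, neg_sub_neg, abs_sub_comm a b,
      abs_sub_comm b (Real.cosh (t / 2) * a)] at h
  have hρ0 : 0 ≤ t * Real.sqrt (4 - a ^ 2) := mul_nonneg ht.1 (Real.sqrt_nonneg _)
  rcases le_total (Real.sqrt (4 - a ^ 2)) (t / 4) with hρ | hρ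
  · have h := abs_sub_add_sq_le_of_sqrt_le ⟨ha0, (abs_le.mp ha).2⟩ (abs_le.mp hb).2 ht hρ
    linarith [abs_nonneg (b - a)]
  · have h := abs_sub_le_abs_cosh_mul_sub (b := b) ha ht
    have htρ : t * (t / 4) ≤ t * Real.sqrt (4 - a ^ 2) := mul_le_mul_of_nonneg_left hρ ht.1
    linarith [abs_nonneg (Real.cosh (t / 2) * a - b)]

/-- Comparison of the shifted-quantile denominator with `|γ_j-γ_k| + t² + tρ_k`,
where `ρ_k = √(4-γ_k²)`. -/
theorem cosh_quantile_comparison :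
    ∃ C : ℝ, 0 < C ∧
      ∀ N : ℕ, 2 ≤ N → ∀ γ : ℕ → ℝ, IsQuantile N γ →
        ∀ j k : ℕ, 1 ≤ j → j ≤ N → 1 ≤ k → k ≤ N → ∀ t : ℝ, t ∈ Set.Icc (0 : ℝ) 1 →
          C⁻¹ * (|γ j - γ k| + t ^ 2 + t * Real.sqrt (4 - γ k ^ 2)) ≤
              |Real.cosh (t / 2) * γ k - γ j| + t * Real.sqrt (4 - γ k ^ 2) ∧
            |Real.cosh (t / 2) * γ k - γ j| + t * Real.sqrt (4 - γ k ^ 2) ≤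
              C * (|γ j - γ k| + t ^ 2 + t * Real.sqrt (4 - γ k ^ 2)) := by
  refine ⟨16, by norm_num, fun N _ γ hγ j k hj1 hjN hk1 hkN t ht => ?_⟩
  have hmem {i : ℕ} (h1 : 1 ≤ i) (hN : i ≤ N) : |γ i| ≤ 2 :=
    abs_le.mpr ⟨(hγ i h1 hN).1.1.le, (hγ i h1 hN).1.2.le⟩
  constructor
  · rw [inv_mul_le_iff₀ (by norm_num)]
    exact abs_sub_add_sq_add_le (hmem hk1 hkN) (hmem hj1 hjN) ht
  · have h := abs_cosh_mul_sub_le (b := γ j) (hmem hk1 hkN) ht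
    have hρ0 : 0 ≤ t * Real.sqrt (4 - γ k ^ 2) := mul_nonneg ht.1 (Real.sqrt_nonneg _)
    linarith [abs_nonneg (γ j - γ k), sq_nonneg t]
end

section
/- For every C₁ > 0 there exist constants C > 0 and c₁ > 0 such that the following holds for every integer N ≥ 2, all indices 1 ≤ a, b ≤ N and every t ∈ (0,1] satisfying |γ_a − γ_b| ≤ C₁·(t² + t·(ρ_a + ρ_b)). First, C⁻¹·(t² + t·ρ_b) ≤ t² + t·ρ_a ≤ C·(t² + t·ρ_b). Second, for every A ≥ 1: if t·ρ_b ≥ A/(N·ρ_b), then t·ρ_a ≥ c₁·A^{1/3}/(N·ρ_a). -/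
open Real MeasureTheory

theorem ρsc_eq {x : ℝ} (hx : x ∈ Set.Icc (-2 : ℝ) 2) :
    ρsc x = √(4 - x ^ 2) / (2 * π) := by
  rw [ρsc, if_pos (abs_le.mpr hx)]

theorem integral_ρsc_eq {a b : ℝ} (ha : -2 ≤ a) (hab : a ≤ b) (hb : b ≤ 2) :
    ∫ x in a..b, ρsc x = ∫ x in a..b, √(4 - x ^ 2) / (2 * π) := by
  refine intervalIntegral.integral_congr fun x hx => ?_
  rw [Set.uIcc_of_le hab] at hx
  exact ρsc_eq ⟨ha.trans hx.1, hx.2.trans hb⟩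

theorem intervalIntegrable_semicircle (a b : ℝ) :
    IntervalIntegrable (fun x : ℝ => √(4 - x ^ 2) / (2 * π)) volume a b :=
  Continuous.intervalIntegrable (by fun_prop) a b

theorem integral_semicircle : ∫ x in (-2 : ℝ)..2, √(4 - x ^ 2) / (2 * π) = 1 := by
  have hscale := intervalIntegral.mul_integral_comp_mul_left
    (f := fun x : ℝ => √(4 - x ^ 2) / (2 * π)) (a := -1) (b := 1) 2
  have hsqrt : ∀ x : ℝ, √(4 - (2 * x) ^ 2) / (2 * π) = √(1 - x ^ 2) * π⁻¹ := fun x => by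
    rw [show 4 - (2 * x) ^ 2 = 2 ^ 2 * (1 - x ^ 2) by ring, sqrt_mul (by norm_num),
      sqrt_sq (by norm_num)]
    field_simp
  simp only [hsqrt, intervalIntegral.integral_mul_const, integral_sqrt_one_sub_sq] at hscale
  norm_num at hscale
  rw [intervalIntegral.integral_div, ← hscale]
  field_simp

/-- The semicircle mass of an interval on which the density is at most its value at `g`. -/
theorem integral_semicircle_le {a b g : ℝ} (hab : a ≤ b)
    (h : ∀ x ∈ Set.Icc a b, g ^ 2 ≤ x ^ 2) :
    ∫ x in a..b, √(4 - x ^ 2) / (2 * π) ≤ (b - a) * (√(4 - g ^ 2) / (2 * π)) := by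
  have hmono := intervalIntegral.integral_mono_on hab (intervalIntegrable_semicircle a b)
    (intervalIntegrable_const (c := √(4 - g ^ 2) / (2 * π))) fun x hx => by
      have := h x hx
      gcongr
  simpa only [intervalIntegral.integral_const, smul_eq_mul] using hmono

theorem inv_le_cube_of_mass_le {N d r : ℝ} (hr : 0 ≤ r) (hd : 2 * d ≤ r ^ 2)
    (h : 1 / 2 / N ≤ d * (r / (2 * π))) : 1 / N ≤ r ^ 3 := by
  have hπ : 1 ≤ π := by linarith [pi_gt_three]
  have hdr : d * (r / (2 * π)) ≤ r ^ 3 / 2 := by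
    rw [mul_div_assoc', div_le_div_iff₀ (by positivity) two_pos]
    nlinarith [mul_le_mul_of_nonneg_right hd hr, mul_le_mul_of_nonneg_left hπ (pow_nonneg hr 3)]
  have : 1 / N = 2 * (1 / 2 / N) := by ring
  linarith

/-- Classical locations stay at distance of order at least `N ^ (-2/3)` from the edges. -/
theorem IsQuantile.inv_le_cube {N : ℕ} {γ : ℕ → ℝ} (h : IsQuantile N γ) {i : ℕ} (hi : 1 ≤ i)
    (hiN : i ≤ N) : 1 / (N : ℝ) ≤ √(4 - γ i ^ 2) ^ 3 := by
  obtain ⟨⟨hl, hu⟩, hmass⟩ := h i hi hiN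
  have hN : (0 : ℝ) < N := by exact_mod_cast hi.trans hiN
  have hi' : (1 : ℝ) ≤ i := by exact_mod_cast hi
  have hiN' : (i : ℝ) ≤ N := by exact_mod_cast hiN
  have hsq : √(4 - γ i ^ 2) ^ 2 = 4 - γ i ^ 2 := sq_sqrt (by nlinarith)
  rw [integral_ρsc_eq hl.le hu.le le_rfl] at hmass
  rcases le_total 0 (γ i) with h0 | h0
  · refine inv_le_cube_of_mass_le (d := 2 - γ i) (sqrt_nonneg _) (by nlinarith) ?_
    refine le_trans ?_ (hmass.symm.trans_le (integral_semicircle_le (g := γ i) hu.le ?_))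
    · gcongr
      linarith
    · intro x hx
      nlinarith [hx.1]
  · refine inv_le_cube_of_mass_le (d := γ i - -2) (sqrt_nonneg _) (by nlinarith) ?_
    refine le_trans ?_ (integral_semicircle_le (g := γ i) hl.le ?_)
    · have hsum := intervalIntegral.integral_add_adjacent_intervals
        (intervalIntegrable_semicircle (-2) (γ i)) (intervalIntegrable_semicircle (γ i) 2)
      rw [integral_semicircle, hmass] at hsum
      have : 1 / 2 / (N : ℝ) + ((i : ℝ) - 1 / 2) / N ≤ 1 := by
        rw [← add_div, div_le_one hN]
        linarith
      linarith
    · intro x hx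
      nlinarith [hx.2]

theorem abs_sqrt_sq_sub_le {g h : ℝ} (hg : g ∈ Set.Ioo (-2 : ℝ) 2) (hh : h ∈ Set.Ioo (-2 : ℝ) 2) :
    |√(4 - g ^ 2) ^ 2 - √(4 - h ^ 2) ^ 2| ≤ 4 * |g - h| := by
  obtain ⟨hg1, hg2⟩ := hg
  obtain ⟨hh1, hh2⟩ := hh
  rw [sq_sqrt (by nlinarith), sq_sqrt (by nlinarith),
    show 4 - g ^ 2 - (4 - h ^ 2) = -((g + h) * (g - h)) by ring, abs_neg, abs_mul]
  gcongr
  rw [abs_le]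
  constructor <;> linarith

theorem le_mul_add_of_sq_sub_le {C t x y : ℝ} (hC : 0 ≤ C) (ht : 0 ≤ t) (hy : 0 ≤ y)
    (h : x ^ 2 - y ^ 2 ≤ 4 * (C * (t ^ 2 + t * (x + y)))) : x ≤ (2 + 4 * C) * (t + y) := by
  refine le_of_sq_le_sq ?_ (by positivity)
  have h1 : 0 ≤ C * t ^ 2 := by positivity
  have h2 : 0 ≤ C * (t * y) := by positivity
  have h3 : 0 ≤ C * y ^ 2 := by positivity
  have h4 : 0 ≤ C ^ 2 * (t * y) := by positivity
  have h5 : 0 ≤ C ^ 2 * y ^ 2 := by positivity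
  have h6 : 0 ≤ t * y := by positivity
  nlinarith [sq_nonneg (x - 4 * C * t), sq_nonneg t, sq_nonneg y]

theorem mul_rpow_third_le {K N A t x y : ℝ} (hK : 1 ≤ K) (hN : 0 < N) (ht : 0 < t) (hx : 0 < x)
    (hy : 0 < y) (hA : 1 ≤ A) (hyx : y ≤ K * (t + x)) (hcube : 1 / N ≤ x ^ 3)
    (h : A / (N * y) ≤ t * y) :
    (4 * K ^ 2)⁻¹ * A ^ ((1 : ℝ) / 3) / (N * x) ≤ t * x := by
  have hA0 : 0 < A := by linarith
  have hroot : (A ^ ((1 : ℝ) / 3)) ^ 3 = A := by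
    rw [← rpow_natCast, ← rpow_mul hA0.le]
    norm_num
  have hrootA : A ^ ((1 : ℝ) / 3) ≤ A := rpow_le_self_of_one_le hA (by norm_num)
  set u := A ^ ((1 : ℝ) / 3)
  have hAy : A ≤ N * t * y ^ 2 := by
    rw [div_le_iff₀ (by positivity)] at h
    linarith
  have hNx : 1 ≤ N * x ^ 3 := by
    rw [div_le_iff₀ hN] at hcube
    linarith
  rw [div_le_iff₀ (by positivity), inv_mul_le_iff₀ (by positivity)]
  rcases le_total t x with htx | htx
  · have hy2 : y ^ 2 ≤ (K * (2 * x)) ^ 2 := by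
      gcongr
      exact hyx.trans (by gcongr; linarith)
    calc u ≤ N * t * y ^ 2 := hrootA.trans hAy
      _ ≤ N * t * (K * (2 * x)) ^ 2 := by gcongr
      _ = 4 * K ^ 2 * (t * x * (N * x)) := by ring
  · have hy2 : y ^ 2 ≤ (K * (2 * t)) ^ 2 := by
      gcongr
      exact hyx.trans (by gcongr; linarith)
    have hM : 1 ≤ 4 * K ^ 2 := by nlinarith
    refine le_of_pow_le_pow_left₀ three_ne_zero (by positivity) ?_
    calc u ^ 3 = A := hroot
      _ ≤ N * t * y ^ 2 := hAy
      _ ≤ N * t * (K * (2 * t)) ^ 2 := by gcongr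
      _ = 4 * K ^ 2 * (N * t ^ 3) * 1 ^ 2 := by ring
      _ ≤ (4 * K ^ 2) ^ 3 * (N * t ^ 3) * (N * x ^ 3) ^ 2 := by
        gcongr
        exact le_self_pow₀ hM three_ne_zero
      _ = (4 * K ^ 2 * (t * x * (N * x))) ^ 3 := by ring

/-- If `|γ_a - γ_b| ≤ C₁ (t² + t(ρ_a + ρ_b))` then `t² + tρ_a ≍ t² + tρ_b`, and
`tρ_b ≥ A/(Nρ_b)` implies `tρ_a ≥ c₁ A^{1/3}/(Nρ_a)`, where `ρ_i = √(4-γ_i²)`. -/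
theorem comparable_scales (C₁ : ℝ) (hC₁ : 0 < C₁) :
    ∃ C c₁ : ℝ, 0 < C ∧ 0 < c₁ ∧
      ∀ N : ℕ, 2 ≤ N → ∀ γ : ℕ → ℝ, IsQuantile N γ →
        ∀ a b : ℕ, 1 ≤ a → a ≤ N → 1 ≤ b → b ≤ N → ∀ t : ℝ, 0 < t → t ≤ 1 →
          |γ a - γ b| ≤ C₁ * (t ^ 2 + t * (Real.sqrt (4 - γ a ^ 2) + Real.sqrt (4 - γ b ^ 2))) →
          ((C⁻¹ * (t ^ 2 + t * Real.sqrt (4 - γ b ^ 2)) ≤ t ^ 2 + t * Real.sqrt (4 - γ a ^ 2) ∧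
              t ^ 2 + t * Real.sqrt (4 - γ a ^ 2) ≤ C * (t ^ 2 + t * Real.sqrt (4 - γ b ^ 2))) ∧
            ∀ A : ℝ, 1 ≤ A →
              A / (N * Real.sqrt (4 - γ b ^ 2)) ≤ t * Real.sqrt (4 - γ b ^ 2) →
              c₁ * A ^ ((1 : ℝ) / 3) / (N * Real.sqrt (4 - γ a ^ 2)) ≤
                t * Real.sqrt (4 - γ a ^ 2)) := by
  have hK : 1 ≤ 2 + 4 * C₁ := by linarith
  refine ⟨3 + 4 * C₁, (4 * (2 + 4 * C₁) ^ 2)⁻¹, by positivity, by positivity, ?_⟩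
  intro N hN γ hγ a b ha haN hb hbN t ht _ hab
  have hN' : (0 : ℝ) < N := by positivity
  obtain ⟨hga, -⟩ := hγ a ha haN
  obtain ⟨hgb, -⟩ := hγ b hb hbN
  have hdiff := (abs_sqrt_sq_sub_le hga hgb).trans (mul_le_mul_of_nonneg_left hab (by norm_num))
  have hcube := hγ.inv_le_cube ha haN
  have hx : 0 < √(4 - γ a ^ 2) := sqrt_pos.mpr (by nlinarith [hga.1, hga.2])
  have hy : 0 < √(4 - γ b ^ 2) := sqrt_pos.mpr (by nlinarith [hgb.1, hgb.2])
  set x := √(4 - γ a ^ 2)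
  set y := √(4 - γ b ^ 2)
  rw [abs_le] at hdiff
  have hxy : x ≤ (2 + 4 * C₁) * (t + y) :=
    le_mul_add_of_sq_sub_le hC₁.le ht.le hy.le hdiff.2
  have hyx : y ≤ (2 + 4 * C₁) * (t + x) :=
    le_mul_add_of_sq_sub_le hC₁.le ht.le hx.le (by linarith [hdiff.1])
  refine ⟨⟨?_, ?_⟩, fun A hA h => mul_rpow_third_le hK hN' ht hx hy hA hyx hcube h⟩
  · rw [inv_mul_le_iff₀ (by positivity)]
    nlinarith [mul_le_mul_of_nonneg_left hyx ht.le, mul_pos ht hx]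
  · nlinarith [mul_le_mul_of_nonneg_left hxy ht.le, mul_pos ht hy]
end

section
/- There exists a constant C > 0 such that for all real numbers η > 0, κ ≥ 0 and t ∈ (0,1]: ∫_0^t √(κ + η_u)/η_u² du ≤ C/η, where η_u := u² + u·√(κ+η) + η. -/
open Real MeasureTheory

/-- Time-integral estimate: `∫_0^t √(κ+η_u)/η_u² du ≤ C/η` where
`η_u = u² + u√(κ+η) + η`. -/
theorem time_integral_bound :
    ∃ C : ℝ, 0 < C ∧
      ∀ η κ t : ℝ, 0 < η → 0 ≤ κ → 0 < t → t ≤ 1 →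
        (∫ u in (0 : ℝ)..t,
            Real.sqrt (κ + (u ^ 2 + u * Real.sqrt (κ + η) + η)) /
              (u ^ 2 + u * Real.sqrt (κ + η) + η) ^ 2) ≤ C / η := by
  refine ⟨1, one_pos, fun η κ t hη hκ ht _ => ?_⟩
  obtain ⟨s, hs⟩ : ∃ s, s = √(κ + η) := ⟨_, rfl⟩
  have hs0 : 0 ≤ s := hs ▸ Real.sqrt_nonneg _
  have hs2 : s ^ 2 = κ + η := hs ▸ Real.sq_sqrt (by positivity)
  rw [← hs]
  have hpos : ∀ u, 0 ≤ u → 0 < u ^ 2 + u * s + η := fun u hu => by positivity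
  have hmem : ∀ u ∈ Set.uIcc 0 t, 0 ≤ u := fun u hu => by
    rw [Set.uIcc_of_le ht.le] at hu
    exact hu.1
  have hne : ∀ u ∈ Set.uIcc 0 t, (u ^ 2 + u * s + η) ^ 2 ≠ 0 := fun u hu =>
    pow_ne_zero 2 (hpos u (hmem u hu)).ne'
  have hint : IntervalIntegrable (fun u => (2 * u + s) / (u ^ 2 + u * s + η) ^ 2) volume 0 t :=
    (ContinuousOn.div (by fun_prop) (by fun_prop) hne).intervalIntegrable
  have hderiv : ∀ u ∈ Set.uIcc 0 t, HasDerivAt (fun u => -(u ^ 2 + u * s + η)⁻¹)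
      ((2 * u + s) / (u ^ 2 + u * s + η) ^ 2) u := fun u hu => by
    have h : HasDerivAt (fun u => u ^ 2 + u * s + η) (2 * u + s) u := by
      simpa using ((hasDerivAt_pow 2 u).add ((hasDerivAt_id u).mul_const s)).add_const η
    have h' := (h.fun_inv (hpos u (hmem u hu)).ne').fun_neg
    rwa [neg_div, neg_neg] at h'
  calc ∫ u in (0 : ℝ)..t, √(κ + (u ^ 2 + u * s + η)) / (u ^ 2 + u * s + η) ^ 2
      ≤ ∫ u in (0 : ℝ)..t, (2 * u + s) / (u ^ 2 + u * s + η) ^ 2 := by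
        refine intervalIntegral.integral_mono_on ht.le
          (ContinuousOn.div (by fun_prop) (by fun_prop) hne).intervalIntegrable hint
          fun u hu => ?_
        have hu0 : 0 ≤ u := hu.1
        gcongr
        refine Real.sqrt_le_iff.2 ⟨by positivity, ?_⟩
        nlinarith [mul_nonneg hu0 hs0]
    _ = η⁻¹ - (t ^ 2 + t * s + η)⁻¹ := by
        rw [intervalIntegral.integral_eq_sub_of_hasDerivAt hderiv hint]
        simp
        ring
    _ ≤ 1 / η := by
        rw [one_div]
        exact sub_le_self _ (inv_nonneg.2 (hpos t ht.le).le)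
end

section
/- Fix β ≥ 1 and ε > 0. Suppose that for every δ > 0 there exists N₁ such that for all integers N ≥ N₁: ∫_{Δ_N ∖ A_δ} p_β(λ) dλ ≤ e^{−φ}·∫_{Δ_N} p_β(λ) dλ, where A_δ := {λ ∈ Δ_N : |λ_i − γ_i| ≤ N^{δ}·N^{−2/3}·î^{−1/3} for all 1 ≤ i ≤ N} and φ := exp((log log N)³). Then there exists N₀ such that for all integers N ≥ N₀, every s ≥ 0 and every a > 0: ∫_{Δ_N} 1{ N^{2/3}·(λ_1 − λ_2) ∈ [s, s+a] }·p_β(λ) dλ ≤ ( N^{ε}·a + e^{−φ} )·∫_{Δ_N} p_β(λ) dλ. -/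
open Real MeasureTheory

/-- The control parameter `φ = exp((log log N)³)`. -/
noncomputable def φctrl (N : ℕ) : ℝ := Real.exp (Real.log (Real.log N) ^ 3)

/-- The simplex `Δ_N = {λ₁ > λ₂ > ⋯ > λ_N}`; coordinate `i : Fin N` is `λ_{i+1}`. -/
def simplexSet (N : ℕ) : Set (Fin N → ℝ) := {lam | ∀ i j : Fin N, i < j → lam j < lam i}

/-- The (unnormalized) Gaussian β-ensemble density on `Fin N → ℝ`. -/
noncomputable def pbetaF (β : ℝ) {N : ℕ} (lam : Fin N → ℝ) : ℝ :=
  Real.exp (β * N *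
    ((N : ℝ)⁻¹ * ∑ i : Fin N, ∑ j : Fin N, (if i < j then Real.log (lam i - lam j) else 0) -
      ∑ i : Fin N, lam i ^ 2 / 4))

/-- If a density loses at most a factor `C` under the translations by `c • v`, `0 ≤ c ≤ τ`, and `g`
increases by `c` under them, then the law of `g` has density at most `2 * C / τ`. -/
lemma setIntegral_window_le_of_shift {E : Type*} [NormedAddCommGroup E] [NormedSpace ℝ E]
    [MeasurableSpace E] [BorelSpace E] (μ : Measure E) [μ.IsAddRightInvariant]
    {p g : E → ℝ} {D B : Set E} {v : E} {τ C s a : ℝ}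
    (hp : ∀ x, 0 ≤ p x) (hD : MeasurableSet D) (hB : MeasurableSet B) (hBD : B ⊆ D)
    (hpD : IntegrableOn p D μ) (hg : Measurable g) (hgv : ∀ x (c : ℝ), g (x + c • v) = g x + c)
    (hτ : 0 < τ) (hC : 0 ≤ C) (ha : 0 < a)
    (hshift : ∀ x ∈ B, ∀ c : ℝ, 0 ≤ c → c ≤ τ → x + c • v ∈ D ∧ p x ≤ C * p (x + c • v)) :
    ∫ x in B ∩ g ⁻¹' Set.Icc s (s + a), p x ∂μ ≤ C * (2 * a / τ) * ∫ x in D, p x ∂μ := by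
  set J := ∫ x in B ∩ g ⁻¹' Set.Icc s (s + a), p x ∂μ with hJ
  set M := ∫ x in D, p x ∂μ
  set W : ℕ → Set E := fun k => D ∩ g ⁻¹' Set.Icc (s + 2 * k * a) (s + 2 * k * a + a) with hW
  have hWm : ∀ k, MeasurableSet (W k) := fun k => hD.inter (hg measurableSet_Icc)
  have hJ0 : 0 ≤ J := integral_nonneg fun x => hp x
  have hWi : ∀ k, IntegrableOn p (W k) μ := fun k => hpD.mono_set Set.inter_subset_left
  set K := ⌊τ / (2 * a)⌋₊ + 1 with hK
  have hstep : ∀ k ∈ Finset.range K, J ≤ C * ∫ x in W k, p x ∂μ := by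
    intro k hk
    have hkτ : 2 * k * a ≤ τ := by
      have h1 : (k : ℝ) ≤ ⌊τ / (2 * a)⌋₊ := by
        exact_mod_cast Nat.lt_succ_iff.mp (Finset.mem_range.mp hk)
      have h2 := h1.trans (Nat.floor_le (by positivity))
      rw [le_div_iff₀ (by positivity)] at h2
      linarith
    have hk0 : (0 : ℝ) ≤ 2 * k * a := by positivity
    set u := (2 * k * a) • v with hu
    have hmp : MeasurePreserving (fun x => x + u) μ μ := measurePreserving_add_right μ u
    have hemb : MeasurableEmbedding (fun x : E => x + u) := measurableEmbedding_addRight u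
    have hsub : B ∩ g ⁻¹' Set.Icc s (s + a) ⊆ (fun x => x + u) ⁻¹' W k := by
      rintro x ⟨hxB, hx1, hx2⟩
      refine ⟨(hshift x hxB _ hk0 hkτ).1, ?_, ?_⟩ <;> rw [hgv] <;> linarith
    have hint : IntegrableOn (fun x => p (x + u)) ((fun x => x + u) ⁻¹' W k) μ :=
      (hmp.integrableOn_comp_preimage hemb).mpr (hWi k)
    calc J ≤ ∫ x in B ∩ g ⁻¹' Set.Icc s (s + a), C * p (x + u) ∂μ := by
          refine setIntegral_mono_on
            (hpD.mono_set (Set.inter_subset_left.trans hBD)) ((hint.mono_set hsub).const_mul C)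
            (hB.inter (hg measurableSet_Icc)) ?_
          exact fun x hx => (hshift x hx.1 _ hk0 hkτ).2
      _ = C * ∫ x in B ∩ g ⁻¹' Set.Icc s (s + a), p (x + u) ∂μ := integral_const_mul _ _
      _ ≤ C * ∫ x in (fun x => x + u) ⁻¹' W k, p (x + u) ∂μ := by
          refine mul_le_mul_of_nonneg_left ?_ hC
          exact setIntegral_mono_set hint (Filter.Eventually.of_forall fun x => hp _)
            hsub.eventuallyLE
      _ = C * ∫ x in W k, p x ∂μ := by rw [hmp.setIntegral_preimage_emb hemb]
  have hdisj : Set.Pairwise (Finset.range K : Set ℕ) (Function.onFun Disjoint W) := by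
    have key : ∀ k l : ℕ, k < l → Disjoint (W k) (W l) := by
      intro k l hkl
      rw [Set.disjoint_left]
      rintro x ⟨-, -, h1⟩ ⟨-, h2, -⟩
      have : (k : ℝ) + 1 ≤ l := by exact_mod_cast hkl
      nlinarith
    intro k _ l _ hkl
    rcases lt_or_gt_of_ne hkl with h | h
    · exact key k l h
    · exact (key l k h).symm
  have hsum : (K : ℝ) * J ≤ C * M := by
    calc (K : ℝ) * J = ∑ _k ∈ Finset.range K, J := by simp
      _ ≤ ∑ k ∈ Finset.range K, C * ∫ x in W k, p x ∂μ := Finset.sum_le_sum hstep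
      _ = C * ∫ x in ⋃ k ∈ Finset.range K, W k, p x ∂μ := by
          rw [← Finset.mul_sum,
            integral_biUnion_finset _ (fun k _ => hWm k) hdisj (fun k _ => hWi k)]
      _ ≤ C * M := by
          refine mul_le_mul_of_nonneg_left ?_ hC
          refine setIntegral_mono_set hpD (Filter.Eventually.of_forall fun x => hp _) ?_
          exact (Set.iUnion₂_subset fun k _ => Set.inter_subset_left).eventuallyLE
  have hKτ : τ / (2 * a) ≤ K := by
    rw [hK]; push_cast; exact (Nat.lt_floor_add_one _).le
  have h3 : τ / (2 * a) * J ≤ C * M := (mul_le_mul_of_nonneg_right hKτ hJ0).trans hsum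
  calc J = (2 * a / τ) * (τ / (2 * a) * J) := by field_simp
    _ ≤ (2 * a / τ) * (C * M) := mul_le_mul_of_nonneg_left h3 (by positivity)
    _ = C * (2 * a / τ) * M := by ring

lemma ρsc_eq_s19 (E : ℝ) : ρsc E = Real.sqrt (4 - E ^ 2) / (2 * Real.pi) := by
  unfold ρsc
  split_ifs with h
  · rfl
  · rw [Real.sqrt_eq_zero_of_nonpos, zero_div]
    have : 2 < |E| := not_le.mp h
    nlinarith [sq_abs E]

lemma ρsc_nonneg (E : ℝ) : 0 ≤ ρsc E := by
  rw [ρsc_eq_s19]; positivity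

lemma continuous_ρsc : Continuous ρsc := by
  have : ρsc = fun E => Real.sqrt (4 - E ^ 2) / (2 * Real.pi) := funext ρsc_eq_s19
  rw [this]; fun_prop

lemma hasDerivAt_arcsin_half {y : ℝ} (hy : y ∈ Set.Ioo (-2 : ℝ) 2) :
    HasDerivAt (fun y => Real.arcsin (y / 2)) (1 / √(4 - y ^ 2)) y := by
  have h := (Real.hasDerivAt_arcsin (x := y / 2) (by linarith [hy.1]) (by linarith [hy.2])).comp y
    ((hasDerivAt_id y).div_const 2)
  refine h.congr_deriv ?_
  have : (4 - y ^ 2) = 2 ^ 2 * (1 - (y / 2) ^ 2) := by ring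
  rw [this, Real.sqrt_mul (by positivity), Real.sqrt_sq (by norm_num)]
  ring

lemma hasDerivAt_sqrt_four_sub_sq {y : ℝ} (hy : y ∈ Set.Ioo (-2 : ℝ) 2) :
    HasDerivAt (fun y : ℝ => √(4 - y ^ 2)) (-y / √(4 - y ^ 2)) y := by
  have hpos : 0 < 4 - y ^ 2 := by nlinarith [hy.1, hy.2]
  have h := (((hasDerivAt_id y).pow 2).const_sub 4).sqrt hpos.ne'
  refine h.congr_deriv ?_
  simp
  ring

lemma integral_ρsc : ∫ x in (-2 : ℝ)..2, ρsc x = 1 := by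
  have h : ∫ x in (-2 : ℝ)..2, ρsc x =
      (2 * (2 : ℝ) * Real.arcsin (2 / 2) / 2 + 2 * √(4 - 2 ^ 2) / 2) / (2 * Real.pi) -
      (2 * (2 : ℝ) * Real.arcsin (-2 / 2) / 2 + -2 * √(4 - (-2) ^ 2) / 2) / (2 * Real.pi) := by
    refine intervalIntegral.integral_eq_sub_of_hasDerivAt_of_le (a := (-2 : ℝ)) (b := 2)
      (f := fun y : ℝ => (2 * (2 : ℝ) * Real.arcsin (y / 2) / 2 + y * √(4 - y ^ 2) / 2) /
        (2 * Real.pi)) (by norm_num) ?_ ?_ ?_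
    · have := Real.continuous_arcsin
      fun_prop
    · intro y hy
      have hpos : 0 < 4 - y ^ 2 := by nlinarith [hy.1, hy.2]
      have h := (((((hasDerivAt_arcsin_half hy).const_mul (2 * (2 : ℝ))).div_const 2).add
        (((hasDerivAt_id y).mul (hasDerivAt_sqrt_four_sub_sq hy)).div_const 2))).div_const
          (2 * Real.pi)
      refine h.congr_deriv ?_
      rw [ρsc_eq_s19]
      congr 1
      have hs : 0 < √(4 - y ^ 2) := Real.sqrt_pos.mpr hpos
      have hsq : √(4 - y ^ 2) ^ 2 = 4 - y ^ 2 := Real.sq_sqrt hpos.le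
      simp only [id]
      field_simp
      linarith
    · exact continuous_ρsc.intervalIntegrable _ _
  rw [h]
  have e : (4 : ℝ) - 2 ^ 2 = 0 := by norm_num
  have e' : (4 : ℝ) - (-2) ^ 2 = 0 := by norm_num
  have e'' : (-2 : ℝ) / 2 = -1 := by norm_num
  rw [e, e', e'', div_self two_ne_zero, Real.arcsin_one, Real.arcsin_neg_one]
  field_simp
  simp
  ring

lemma continuousOn_ρsc_div {w : ℝ} (hw : 0 < w) :
    ContinuousOn (fun y => ρsc y / (2 + w - y)) (Set.Icc (-2) 2) :=
  continuous_ρsc.continuousOn.div (by fun_prop) fun y hy => by linarith [hy.2]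

/-- The Stieltjes transform of the semicircle law is at least `1 - √w` at distance `w` from the
edge. -/
lemma one_sub_sqrt_le_integral_ρsc_div {w : ℝ} (hw : 0 < w) :
    1 - √w ≤ ∫ y in (-2 : ℝ)..2, ρsc y / (2 + w - y) := by
  set G : ℝ → ℝ := fun y =>
    (2 * Real.arcsin (y / 2) - √(4 - y ^ 2) + 4 * √w * Real.arctan (√(2 - y) / √w)) /
      (2 * Real.pi) with hG
  have hsw : 0 < √w := Real.sqrt_pos.mpr hw
  have hsw2 : √w ^ 2 = w := Real.sq_sqrt hw.le
  have key : G 2 - G (-2) ≤ ∫ y in (-2 : ℝ)..2, ρsc y / (2 + w - y) := by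
    refine intervalIntegral.sub_le_integral_of_hasDeriv_right_of_le
      (g' := fun y => (2 * (1 / √(4 - y ^ 2)) - (-y / √(4 - y ^ 2)) +
        4 * √w * (1 / (1 + (√(2 - y) / √w) ^ 2) * ((-1) / (2 * √(2 - y)) / √w))) /
          (2 * Real.pi)) (by norm_num) ?_ ?_ ?_ ?_
    · have := Real.continuous_arcsin
      have := Real.continuous_arctan
      apply Continuous.continuousOn
      fun_prop
    · intro y hy
      have h2 : 0 < 2 - y := by linarith [hy.2]
      have h3 : HasDerivAt (fun y : ℝ => √(2 - y)) ((-1) / (2 * √(2 - y))) y :=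
        ((hasDerivAt_id' y).const_sub 2).sqrt h2.ne'
      exact (((((hasDerivAt_arcsin_half hy).const_mul 2).sub
        (hasDerivAt_sqrt_four_sub_sq hy)).add
        (((h3.div_const (√w)).arctan).const_mul (4 * √w))).div_const
          (2 * Real.pi)).hasDerivWithinAt
    · exact (continuousOn_ρsc_div hw).integrableOn_Icc
    · intro y hy
      have h2 : 0 < 2 - y := by linarith [hy.2]
      have h2' : 0 < 2 + y := by linarith [hy.1]
      rw [ρsc_eq_s19, div_right_comm (√(4 - y ^ 2))]
      refine div_le_div_of_nonneg_right ?_ (by positivity)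
      set b := √(2 - y) with hb
      set d := √(2 + y) with hd
      have hb0 : 0 < b := Real.sqrt_pos.mpr h2
      have hd0 : 0 < d := Real.sqrt_pos.mpr h2'
      have hb2 : b ^ 2 = 2 - y := Real.sq_sqrt h2.le
      have hd2 : d ^ 2 = 2 + y := Real.sq_sqrt h2'.le
      have hbd : √(4 - y ^ 2) = b * d := by
        rw [hb, hd, ← Real.sqrt_mul h2.le]; congr 1; ring
      have hd4 : d ≤ 2 := by nlinarith [hy.2]
      have e1 : 2 * (1 / (b * d)) - (-y / (b * d)) = d / b := by
        field_simp; linarith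
      have e2 : 4 * √w * (1 / (1 + (b / √w) ^ 2) * ((-1) / (2 * b) / √w)) =
          -(2 * w / (b * (w + b ^ 2))) := by
        rw [div_pow, hsw2]; field_simp; norm_num
      have e3 : 2 + w - y = w + b ^ 2 := by linarith
      rw [hbd, e1, e2, e3]
      have e4 : d / b + -(2 * w / (b * (w + b ^ 2))) =
          b * d / (w + b ^ 2) - (2 - d) * w / (b * (w + b ^ 2)) := by
        field_simp; ring
      rw [e4]
      have : 0 ≤ (2 - d) * w / (b * (w + b ^ 2)) := by
        have : 0 ≤ 2 - d := by linarith
        positivity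
      linarith
  refine le_trans ?_ key
  have e : (4 : ℝ) - 2 ^ 2 = 0 := by norm_num
  have e' : (4 : ℝ) - (-2) ^ 2 = 0 := by norm_num
  have e'' : (-2 : ℝ) / 2 = -1 := by norm_num
  have hπ := Real.pi_pos
  simp only [hG]
  rw [e, e', e'', div_self two_ne_zero, Real.arcsin_one, Real.arcsin_neg_one, ← sub_div,
    le_div_iff₀ (by positivity)]
  have := Real.arctan_lt_pi_div_two (√(2 - -2) / √w)
  have := mul_lt_mul_of_pos_left this hsw
  simp
  nlinarith

/-- The lower Riemann sum bound for the Stieltjes transform of the classical locations. -/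
lemma sum_inv_quantile_ge {n : ℕ} {γ : ℕ → ℝ} (hγ : IsQuantile (n + 1) γ) {w : ℝ} (hw : 0 < w) :
    ((n + 1 : ℕ) : ℝ) * (1 - √w) - 2 / w ≤ ∑ k ∈ Finset.range n, 1 / (2 + w - γ (k + 2)) := by
  set N : ℝ := ((n + 1 : ℕ) : ℝ) with hN
  have hN0 : 0 < N := by positivity
  set ψ : ℝ → ℝ := fun y => ρsc y / (2 + w - y) with hψ
  have hρi : ∀ a b : ℝ, IntervalIntegrable ρsc volume a b :=
    fun a b => continuous_ρsc.intervalIntegrable a b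
  have hψi : ∀ a ∈ Set.Icc (-2 : ℝ) 2, ∀ b ∈ Set.Icc (-2 : ℝ) 2,
      IntervalIntegrable ψ volume a b := fun a ha b hb =>
    ((continuousOn_ρsc_div hw).mono (Set.uIcc_subset_Icc ha hb)).intervalIntegrable
  have hψle : ∀ a b : ℝ, -2 ≤ a → a ≤ b → b ≤ 2 →
      ∫ y in a..b, ψ y ≤ 1 / (2 + w - b) * ∫ y in a..b, ρsc y := by
    intro a b ha hab hb
    rw [← intervalIntegral.integral_const_mul]
    refine intervalIntegral.integral_mono_on hab
      (hψi a ⟨ha, hab.trans hb⟩ b ⟨ha.trans hab, hb⟩) ((hρi a b).const_mul _) ?_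
    intro y hy
    have h1 : 0 < 2 + w - b := by linarith
    have : 1 / (2 + w - y) ≤ 1 / (2 + w - b) := one_div_le_one_div_of_le h1 (by linarith [hy.2])
    calc ψ y = 1 / (2 + w - y) * ρsc y := by simp only [hψ]; ring
      _ ≤ _ := mul_le_mul_of_nonneg_right this (ρsc_nonneg y)
  have hmem : ∀ k ≤ n, γ (k + 1) ∈ Set.Icc (-2 : ℝ) 2 := fun k hk =>
    Set.Ioo_subset_Icc_self (hγ (k + 1) (by omega) (by omega)).1
  have hval : ∀ k ≤ n, ∫ x in (γ (k + 1))..(2 : ℝ), ρsc x = ((k : ℝ) + 1 / 2) / N := by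
    intro k hk
    rw [(hγ (k + 1) (by omega) (by omega)).2]
    congr 1
    push_cast
    ring
  have h2mem : (2 : ℝ) ∈ Set.Icc (-2 : ℝ) 2 := by norm_num
  have hm2mem : (-2 : ℝ) ∈ Set.Icc (-2 : ℝ) 2 := by norm_num
  have hincr : ∀ k < n, N * ∫ y in (γ (k + 2))..(γ (k + 1)), ψ y ≤ 1 / (2 + w - γ (k + 1)) := by
    intro k hk
    have hsplit := intervalIntegral.integral_add_adjacent_intervals
      (hρi (γ (k + 2)) (γ (k + 1))) (hρi (γ (k + 1)) 2)
    have hv2 := hval (k + 1) hk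
    rw [hval k hk.le, hv2] at hsplit
    have hmass : ∫ y in (γ (k + 2))..(γ (k + 1)), ρsc y = 1 / N := by
      push_cast at hsplit
      have : ((k : ℝ) + 1 + 1 / 2) / N = 1 / N + (k + 1 / 2) / N := by ring
      linarith
    have hmono : γ (k + 2) ≤ γ (k + 1) := by
      by_contra! hlt
      have : 0 ≤ ∫ y in (γ (k + 1))..(γ (k + 2)), ρsc y :=
        intervalIntegral.integral_nonneg hlt.le fun y _ => ρsc_nonneg y
      rw [intervalIntegral.integral_symm, hmass] at this
      have : 0 < 1 / N := by positivity
      linarith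
    have := hψle _ _ (hmem (k + 1) hk).1 hmono (hmem k hk.le).2
    rw [hmass] at this
    calc N * ∫ y in (γ (k + 2))..(γ (k + 1)), ψ y ≤ N * (1 / (2 + w - γ (k + 1)) * (1 / N)) :=
          mul_le_mul_of_nonneg_left this hN0.le
      _ = _ := by field_simp
  have htel : ∀ m ≤ n, N * ∫ y in (γ (m + 1))..(γ 1), ψ y ≤
      ∑ k ∈ Finset.range m, 1 / (2 + w - γ (k + 1)) := by
    intro m
    induction m with
    | zero => intro _; simp
    | succ m ih =>
      intro hm
      rw [Finset.sum_range_succ, ← intervalIntegral.integral_add_adjacent_intervals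
        (hψi _ (hmem (m + 1) hm) _ (hmem m (by omega)))
        (hψi _ (hmem m (by omega)) _ (hmem 0 (by omega))), mul_add]
      linarith [ih (by omega), hincr m hm]
  have hlast : ∫ y in (-2 : ℝ)..(γ (n + 1)), ρsc y = 1 / (2 * N) := by
    have hsplit := intervalIntegral.integral_add_adjacent_intervals
      (hρi (-2) (γ (n + 1))) (hρi (γ (n + 1)) 2)
    rw [integral_ρsc, hval n le_rfl] at hsplit
    have : ((n : ℝ) + 1 / 2) / N = 1 - 1 / (2 * N) := by
      have : (n : ℝ) = N - 1 := by rw [hN]; push_cast; ring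
      rw [this]; field_simp; ring
    linarith
  have hinv : ∀ k ≤ n, 0 ≤ 1 / (2 + w - γ (k + 1)) ∧ 1 / (2 + w - γ (k + 1)) ≤ 1 / w := by
    intro k hk
    have := (hmem k hk).2
    exact ⟨one_div_nonneg.mpr (by linarith), one_div_le_one_div_of_le hw (by linarith)⟩
  have hleft := hψle (-2) (γ (n + 1)) le_rfl (hmem n le_rfl).1 (hmem n le_rfl).2
  have hright := hψle (γ 1) 2 (hmem 0 (by omega)).1 (hmem 0 (by omega)).2 le_rfl
  rw [hlast] at hleft
  have h0 := hval 0 (by omega)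
  rw [zero_add] at h0
  rw [h0] at hright
  have hleft' : ∫ y in (-2 : ℝ)..(γ (n + 1)), ψ y ≤ 1 / w * (1 / (2 * N)) :=
    hleft.trans (mul_le_mul_of_nonneg_right (hinv n le_rfl).2 (by positivity))
  have htot := one_sub_sqrt_le_integral_ρsc_div hw
  rw [← intervalIntegral.integral_add_adjacent_intervals
      (hψi _ hm2mem _ (hmem n le_rfl)) (hψi _ (hmem n le_rfl) _ h2mem),
    ← intervalIntegral.integral_add_adjacent_intervals
      (hψi _ (hmem n le_rfl) _ (hmem 0 (by omega))) (hψi _ (hmem 0 (by omega)) _ h2mem)] at htot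
  have hright' : ∫ y in (γ 1)..(2 : ℝ), ψ y ≤ 1 / w * (1 / (2 * N)) := by
    refine hright.trans (le_of_eq ?_)
    have : (2 : ℝ) + w - 2 = w := by ring
    rw [this]; push_cast; field_simp; ring
  have hsum1 : N * (1 - √w) - 1 / w ≤ ∑ k ∈ Finset.range n, 1 / (2 + w - γ (k + 1)) := by
    refine le_trans ?_ (htel n le_rfl)
    have hmid : (1 - √w) - 1 / (w * N) ≤ ∫ y in (γ (n + 1))..(γ 1), ψ y := by
      have : 1 / w * (1 / (2 * N)) + 1 / w * (1 / (2 * N)) = 1 / (w * N) := by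
        field_simp; ring
      simp only [zero_add] at htot
      linarith
    have := mul_le_mul_of_nonneg_left hmid hN0.le
    have e : N * ((1 - √w) - 1 / (w * N)) = N * (1 - √w) - 1 / w := by field_simp
    linarith
  have hsum2 := Finset.sum_range_succ (fun k => 1 / (2 + w - γ (k + 1))) n
  rw [Finset.sum_range_succ'] at hsum2
  have h1 := (hinv n le_rfl).1
  have h2 := (hinv 0 (by omega)).2
  have e : 2 / w = 1 / w + 1 / w := by ring
  simp only [zero_add] at hsum2 h2
  have e2 : ∀ k : ℕ, k + 1 + 1 = k + 2 := fun k => rfl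
  simp only [e2] at hsum2
  linarith

lemma add_single_mem_simplexSet {N : ℕ} {lam : Fin N → ℝ} (hlam : lam ∈ simplexSet N)
    {i₀ : Fin N} (hi₀ : i₀.val = 0) {t : ℝ} (ht : 0 ≤ t) :
    lam + Pi.single i₀ t ∈ simplexSet N := by
  intro i j hij
  have hj : j ≠ i₀ := by
    rintro rfl
    have : i.val < j.val := hij
    omega
  rw [Pi.add_apply, Pi.add_apply, Pi.single_eq_of_ne hj, add_zero]
  have h := hlam i j hij
  by_cases hi : i = i₀
  · subst hi; rw [Pi.single_eq_same]; linarith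
  · rwa [Pi.single_eq_of_ne hi, add_zero]

lemma sum_log_add_single_ge {N : ℕ} {lam : Fin N → ℝ} (hlam : lam ∈ simplexSet N)
    {i₀ : Fin N} (hi₀ : i₀.val = 0) {t z : ℝ} (ht : 0 ≤ t) {γ : ℕ → ℝ}
    (hz : ∀ j : Fin N, lam i₀ + t - lam j ≤ z - γ (j.val + 1)) :
    (∑ i : Fin N, ∑ j : Fin N, (if i < j then Real.log (lam i - lam j) else 0)) +
        t * ∑ j : Fin N, (if i₀ < j then 1 / (z - γ (j.val + 1)) else 0) ≤
      ∑ i : Fin N, ∑ j : Fin N, (if i < j then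
        Real.log ((lam + Pi.single i₀ t : Fin N → ℝ) i - (lam + Pi.single i₀ t : Fin N → ℝ) j) else 0) := by
  set Q := t * ∑ j : Fin N, (if i₀ < j then 1 / (z - γ (j.val + 1)) else 0) with hQ
  have hne : ∀ i j : Fin N, i < j → j ≠ i₀ := by
    rintro i j hij rfl
    have : i.val < j.val := hij
    omega
  have hQ' : Q = ∑ i : Fin N, if i = i₀ then Q else 0 := by simp
  rw [hQ', ← Finset.sum_add_distrib]
  refine Finset.sum_le_sum fun i _ => ?_
  split_ifs with hi
  · subst hi
    rw [hQ, Finset.mul_sum, ← Finset.sum_add_distrib]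
    refine Finset.sum_le_sum fun j _ => ?_
    split_ifs with hj
    · have hpos : 0 < lam i - lam j := sub_pos.mpr (hlam i j hj)
      have hpos' : 0 < lam i + t - lam j := by linarith
      rw [Pi.add_apply, Pi.add_apply, Pi.single_eq_of_ne (hne i j hj), Pi.single_eq_same, add_zero]
      have h1 := Real.one_sub_inv_le_log_of_pos (div_pos hpos' hpos)
      rw [Real.log_div hpos'.ne' hpos.ne'] at h1
      have h2 : 1 - ((lam i + t - lam j) / (lam i - lam j))⁻¹ = t * (1 / (lam i + t - lam j)) := by
        field_simp; ring
      have h3 := mul_le_mul_of_nonneg_left (one_div_le_one_div_of_le hpos' (hz j)) ht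
      linarith
    · simp
  · rw [add_zero]
    refine Finset.sum_le_sum fun j _ => ?_
    split_ifs with hj
    · rw [Pi.add_apply, Pi.add_apply, Pi.single_eq_of_ne (hne i j hj), Pi.single_eq_of_ne hi,
        add_zero, add_zero]
    · exact le_rfl

lemma sum_sq_add_single {N : ℕ} (lam : Fin N → ℝ) (i₀ : Fin N) (t : ℝ) :
    ∑ i : Fin N, (lam + Pi.single i₀ t : Fin N → ℝ) i ^ 2 / 4 =
      ∑ i : Fin N, lam i ^ 2 / 4 + (2 * t * lam i₀ + t ^ 2) / 4 := by
  have : (2 * t * lam i₀ + t ^ 2) / 4 =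
      ∑ i : Fin N, if i = i₀ then (2 * t * lam i₀ + t ^ 2) / 4 else 0 := by simp
  rw [this, ← Finset.sum_add_distrib]
  refine Finset.sum_congr rfl fun i _ => ?_
  rw [Pi.add_apply]
  split_ifs with hi
  · subst hi; rw [Pi.single_eq_same]; ring
  · rw [Pi.single_eq_of_ne hi]; ring

/-- Moving the top particle up by `t` costs only a controlled factor when the configuration is
within `η` of the classical locations. -/
lemma pbetaF_le_pbetaF_add_single {β : ℝ} (hβ : 0 ≤ β) {n : ℕ} {γ : ℕ → ℝ}
    (hγ : IsQuantile (n + 1) γ) {lam : Fin (n + 1) → ℝ} (hlam : lam ∈ simplexSet (n + 1))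
    {η t : ℝ} (hη : 0 < η) (ht : 0 ≤ t) (htη : t ≤ η)
    (hrig : ∀ j : Fin (n + 1), |lam j - γ (j.val + 1)| ≤ η) :
    pbetaF β lam ≤ Real.exp (β * (t * (((n + 1 : ℕ) : ℝ) * √(3 * η) + 2 / (3 * η) +
        ((n + 1 : ℕ) : ℝ) * η / 2 + ((n + 1 : ℕ) : ℝ) * t / 4))) *
      pbetaF β (lam + Pi.single 0 t) := by
  have h0 : lam 0 ≤ 2 + η := by
    have h1 := (abs_le.mp (hrig 0)).2
    have h2 := (hγ 1 le_rfl (by omega)).1.2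
    simp only [Fin.val_zero, zero_add] at h1
    linarith
  have hlog := sum_log_add_single_ge hlam (i₀ := 0) rfl (z := 2 + 3 * η) (γ := γ) ht fun j => by
    have := (abs_le.mp (hrig j)).1
    linarith
  have hsum : ∑ j : Fin (n + 1), (if (0 : Fin (n + 1)) < j then
      1 / (2 + 3 * η - γ (j.val + 1)) else 0) =
      ∑ k ∈ Finset.range n, 1 / (2 + 3 * η - γ (k + 2)) := by
    rw [Fin.sum_univ_succ, ← Fin.sum_univ_eq_sum_range (fun k => 1 / (2 + 3 * η - γ (k + 2)))]
    simp
  have hst := sum_inv_quantile_ge hγ (w := 3 * η) (by positivity)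
  rw [hsum] at hlog
  set N : ℝ := ((n + 1 : ℕ) : ℝ) with hN
  have hN0 : 0 < N := by positivity
  unfold pbetaF
  rw [← Real.exp_add, Real.exp_le_exp, sum_sq_add_single]
  set S := ∑ i : Fin (n + 1), ∑ j : Fin (n + 1), (if i < j then Real.log (lam i - lam j) else 0)
  set S' := ∑ i : Fin (n + 1), ∑ j : Fin (n + 1), (if i < j then
        Real.log ((lam + Pi.single 0 t : Fin (n + 1) → ℝ) i -
          (lam + Pi.single 0 t : Fin (n + 1) → ℝ) j) else 0)
  set V := ∑ i : Fin (n + 1), lam i ^ 2 / 4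
  have e : ∀ a b : ℝ, β * N * (N⁻¹ * a - b) = β * (a - N * b) := by
    intro a b; field_simp
  rw [← hN, e, e, ← mul_add]
  refine mul_le_mul_of_nonneg_left ?_ hβ
  have h3 := mul_le_mul_of_nonneg_left hst ht
  have h4 : N * t * lam 0 ≤ N * t * (2 + η) := mul_le_mul_of_nonneg_left h0 (by positivity)
  linear_combination hlog + h3 + h4 / 2

lemma measurableSet_simplexSet (N : ℕ) : MeasurableSet (simplexSet N) := by
  have : simplexSet N = ⋂ i : Fin N, ⋂ j : Fin N, ⋂ _ : i < j, {lam | lam j < lam i} := by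
    ext; simp [simplexSet]
  rw [this]
  exact MeasurableSet.iInter fun i => MeasurableSet.iInter fun j => MeasurableSet.iInter fun _ =>
    measurableSet_lt (measurable_pi_apply j) (measurable_pi_apply i)

lemma measurableSet_simplexSet_near (N : ℕ) (c b : Fin N → ℝ) :
    MeasurableSet {lam ∈ simplexSet N | ∀ i : Fin N, |lam i - c i| ≤ b i} := by
  have : {lam ∈ simplexSet N | ∀ i : Fin N, |lam i - c i| ≤ b i} =
      simplexSet N ∩ ⋂ i : Fin N, {lam | |lam i - c i| ≤ b i} := by
    ext; simp
  rw [this]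
  refine (measurableSet_simplexSet N).inter (MeasurableSet.iInter fun i => ?_)
  exact measurableSet_le (by fun_prop) measurable_const

/-- The total cost of the shift at the edge scale; here `x = N ^ δ` and `y = N ^ (1 / 3)`. -/
lemma edge_shift_cost_le {x y t : ℝ} (hx : 1 ≤ x) (hy : 1 ≤ y) (ht : 0 ≤ t)
    (htT : t ≤ 1 / (x * y ^ 2)) :
    t * (y ^ 3 * √(3 * (x / y ^ 2)) + 2 / (3 * (x / y ^ 2)) + y ^ 3 * (x / y ^ 2) / 2 +
      y ^ 3 * t / 4) ≤ 5 := by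
  have hx0 : 0 < x := by linarith
  have hy0 : 0 < y := by linarith
  have hs : √(3 * (x / y ^ 2)) ≤ 2 * x / y := by
    rw [Real.sqrt_le_left (by positivity), div_pow, mul_div_assoc']
    gcongr
    nlinarith
  have h1 : 2 / (3 * (x / y ^ 2)) ≤ y ^ 2 := by
    rw [div_le_iff₀ (by positivity)]
    field_simp
    linarith
  have h2 : y ^ 3 * (x / y ^ 2) / 2 ≤ x * y ^ 2 := by
    have : y ^ 3 * (x / y ^ 2) / 2 = x * y / 2 := by field_simp
    rw [this]; nlinarith [mul_pos hx0 hy0]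
  have hT1 : 1 / (x * y ^ 2) ≤ 1 := by
    rw [div_le_one (by positivity)]; nlinarith
  have h3 : y ^ 3 * t / 4 ≤ y ^ 2 := by
    have : y ^ 3 * t ≤ y ^ 3 * (1 / (x * y ^ 2)) :=
      mul_le_mul_of_nonneg_left htT (by positivity)
    have e : y ^ 3 * (1 / (x * y ^ 2)) = y / x := by field_simp
    have : y / x ≤ y := div_le_self hy0.le hx
    nlinarith
  have h4 : y ^ 3 * √(3 * (x / y ^ 2)) ≤ 2 * x * y ^ 2 := by
    calc y ^ 3 * √(3 * (x / y ^ 2)) ≤ y ^ 3 * (2 * x / y) :=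
          mul_le_mul_of_nonneg_left hs (by positivity)
      _ = _ := by field_simp
  have h5 : y ^ 2 ≤ x * y ^ 2 := le_mul_of_one_le_left (by positivity) hx
  calc _ ≤ t * (5 * (x * y ^ 2)) := mul_le_mul_of_nonneg_left (by linarith) ht
    _ ≤ 1 / (x * y ^ 2) * (5 * (x * y ^ 2)) := mul_le_mul_of_nonneg_right htT (by positivity)
    _ = 5 := by field_simp

/-- Assuming rigidity for the Gaussian β-ensemble, the rescaled top gap
`N^{2/3}(λ₁-λ₂)` has a bounded density up to `e^{-φ}` errors. -/
theorem top_gap_bounded_density (β ε : ℝ) (hβ : 1 ≤ β) (hε : 0 < ε)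
    (γ : ℕ → ℕ → ℝ) (hγ : ∀ N : ℕ, 2 ≤ N → IsQuantile N (γ N))
    (hint : ∀ N : ℕ, 2 ≤ N →
      MeasureTheory.IntegrableOn (fun lam : Fin N → ℝ => pbetaF β lam) (simplexSet N) ∧
        0 < ∫ lam in simplexSet N, pbetaF β lam)
    (hrig : ∀ δ : ℝ, 0 < δ → ∃ N₁ : ℕ, ∀ N : ℕ, N₁ ≤ N →
      (∫ lam in simplexSet N \
          {lam ∈ simplexSet N | ∀ i : Fin N,
            |lam i - γ N (i.val + 1)| ≤ (N : ℝ) ^ δ * (N : ℝ) ^ (-(2 : ℝ) / 3) *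
              ((min (i.val + 1) (N - i.val) : ℕ) : ℝ) ^ (-(1 : ℝ) / 3)},
        pbetaF β lam) ≤ Real.exp (-φctrl N) * ∫ lam in simplexSet N, pbetaF β lam) :
    ∃ N₀ : ℕ, ∀ N : ℕ, N₀ ≤ N → ∀ (hN : 2 ≤ N), ∀ s a : ℝ, 0 ≤ s → 0 < a →
      (∫ lam in {lam ∈ simplexSet N |
          (N : ℝ) ^ ((2 : ℝ) / 3) * (lam ⟨0, by omega⟩ - lam ⟨1, by omega⟩) ∈
            Set.Icc s (s + a)},
        pbetaF β lam) ≤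
        ((N : ℝ) ^ ε * a + Real.exp (-φctrl N)) * ∫ lam in simplexSet N, pbetaF β lam := by
  have hβ0 : 0 ≤ β := by linarith
  set δ := ε / 2 with hδ
  have hδ0 : 0 < δ := by positivity
  obtain ⟨N₁, hN₁⟩ := hrig δ hδ0
  have hlim : Filter.Tendsto (fun N : ℕ => (N : ℝ) ^ δ) Filter.atTop Filter.atTop :=
    (tendsto_rpow_atTop hδ0).comp tendsto_natCast_atTop_atTop
  obtain ⟨N₂, hN₂⟩ := Filter.eventually_atTop.mp
    (hlim.eventually_ge_atTop (2 * Real.exp (β * 5)))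
  refine ⟨max N₁ N₂, fun N hNN hN s a _ ha => ?_⟩
  have hlarge := hN₂ N ((le_max_right _ _).trans hNN)
  have hbad := hN₁ N ((le_max_left _ _).trans hNN)
  obtain ⟨n, rfl⟩ : ∃ n, N = n + 1 := ⟨N - 1, by omega⟩
  set A : Set (Fin (n + 1) → ℝ) := {lam ∈ simplexSet (n + 1) | ∀ i : Fin (n + 1),
    |lam i - γ (n + 1) (i.val + 1)| ≤ ((n + 1 : ℕ) : ℝ) ^ δ * ((n + 1 : ℕ) : ℝ) ^ (-(2 : ℝ) / 3) *
      ((min (i.val + 1) (n + 1 - i.val) : ℕ) : ℝ) ^ (-(1 : ℝ) / 3)} with hA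
  obtain ⟨hpint, -⟩ := hint (n + 1) hN
  have hquant := hγ (n + 1) hN
  set N : ℝ := ((n + 1 : ℕ) : ℝ) with hNdef
  have hN1 : 1 ≤ N := by rw [hNdef]; push_cast; linarith [n.cast_nonneg (α := ℝ)]
  have hN0 : 0 < N := by linarith
  set x := N ^ δ with hx
  set y := N ^ ((1 : ℝ) / 3) with hy
  have hx1 : 1 ≤ x := Real.one_le_rpow hN1 hδ0.le
  have hy1 : 1 ≤ y := Real.one_le_rpow hN1 (by norm_num)
  have hx0 : 0 < x := by linarith
  have hy0 : 0 < y := by linarith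
  have hy3 : N = y ^ 3 := by
    rw [hy, ← Real.rpow_natCast, ← Real.rpow_mul hN0.le]; norm_num
  have hy2 : N ^ ((2 : ℝ) / 3) = y ^ 2 := by
    rw [hy, ← Real.rpow_natCast, ← Real.rpow_mul hN0.le]; norm_num
  have hy2' : N ^ (-(2 : ℝ) / 3) = 1 / y ^ 2 := by
    rw [neg_div, Real.rpow_neg hN0.le, hy2, one_div]
  have hxε : N ^ ε = x * x := by
    rw [hx, ← Real.rpow_add hN0, hδ]; congr 1; ring
  set g : (Fin (n + 1) → ℝ) → ℝ := fun lam =>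
    y ^ 2 * (lam ⟨0, by omega⟩ - lam ⟨1, by omega⟩) with hg
  have hgm : Measurable g := by
    rw [hg]; fun_prop
  have hΔ := measurableSet_simplexSet (n + 1)
  have hAm : MeasurableSet A := measurableSet_simplexSet_near _ _ _
  have hAη : ∀ lam ∈ A, ∀ i : Fin (n + 1), |lam i - γ (n + 1) (i.val + 1)| ≤ x / y ^ 2 := by
    intro lam hlam i
    refine (hlam.2 i).trans ?_
    rw [hy2']
    have : ((min (i.val + 1) (n + 1 - i.val) : ℕ) : ℝ) ^ (-(1 : ℝ) / 3) ≤ 1 := by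
      refine Real.rpow_le_one_of_one_le_of_nonpos ?_ (by norm_num)
      have := i.isLt
      exact_mod_cast (by omega : 1 ≤ min (i.val + 1) (n + 1 - i.val))
    calc _ ≤ x * (1 / y ^ 2) * 1 := mul_le_mul_of_nonneg_left this (by positivity)
      _ = _ := by ring
  have hwin := setIntegral_window_le_of_shift (E := Fin (n + 1) → ℝ) volume (p := pbetaF β)
    (g := g) (D := simplexSet (n + 1)) (B := A) (v := Pi.single 0 (1 / y ^ 2)) (τ := 1 / x)
    (C := Real.exp (β * 5)) (s := s) (a := a) (fun _ => (Real.exp_pos _).le) hΔ hAm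
    (fun _ h => h.1) hpint hgm
    (by
      intro lam c
      have h01 : (⟨1, by omega⟩ : Fin (n + 1)) ≠ 0 := by
        intro h; simpa using congrArg Fin.val h
      have h00 : (⟨0, by omega⟩ : Fin (n + 1)) = 0 := rfl
      simp only [hg, Pi.add_apply, Pi.smul_apply, smul_eq_mul, h00, Pi.single_eq_same,
        Pi.single_eq_of_ne h01]
      field_simp
      ring)
    (by positivity) (Real.exp_pos _).le ha
    (by
      intro lam hlam c hc hcτ
      have ht : 0 ≤ c * (1 / y ^ 2) := by positivity
      have htT : c * (1 / y ^ 2) ≤ 1 / (x * y ^ 2) := by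
        calc c * (1 / y ^ 2) ≤ 1 / x * (1 / y ^ 2) :=
              mul_le_mul_of_nonneg_right hcτ (by positivity)
          _ = _ := by field_simp
      have htη : c * (1 / y ^ 2) ≤ x / y ^ 2 := by
        have : c ≤ x := hcτ.trans (((div_le_one hx0).mpr hx1).trans hx1)
        calc c * (1 / y ^ 2) ≤ x * (1 / y ^ 2) := mul_le_mul_of_nonneg_right this (by positivity)
          _ = _ := by ring
      rw [← Pi.single_smul, smul_eq_mul]
      refine ⟨add_single_mem_simplexSet hlam.1 rfl ht, ?_⟩
      refine (pbetaF_le_pbetaF_add_single hβ0 hquant hlam.1 (by positivity) ht htη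
        (hAη lam hlam)).trans ?_
      refine mul_le_mul_of_nonneg_right ?_ (Real.exp_pos _).le
      rw [Real.exp_le_exp, ← hNdef, hy3]
      exact mul_le_mul_of_nonneg_left (edge_shift_cost_le hx1 hy1 ht htT) hβ0)
  set M := ∫ lam in simplexSet (n + 1), pbetaF β lam with hM
  have hM0 : 0 ≤ M := integral_nonneg fun _ => (Real.exp_pos _).le
  have hcoef : Real.exp (β * 5) * (2 * a / (1 / x)) ≤ N ^ ε * a := by
    rw [hxε]
    calc Real.exp (β * 5) * (2 * a / (1 / x)) = 2 * Real.exp (β * 5) * (x * a) := by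
          field_simp
      _ ≤ x * (x * a) := mul_le_mul_of_nonneg_right hlarge (by positivity)
      _ = _ := by ring
  have hsub : {lam ∈ simplexSet (n + 1) |
      N ^ ((2 : ℝ) / 3) * (lam ⟨0, by omega⟩ - lam ⟨1, by omega⟩) ∈ Set.Icc s (s + a)} ⊆
      (A ∩ g ⁻¹' Set.Icc s (s + a)) ∪ (simplexSet (n + 1) \ A) := by
    rintro lam ⟨h1, h2⟩
    rw [hy2] at h2
    by_cases h : lam ∈ A
    · exact Or.inl ⟨h, h2⟩
    · exact Or.inr ⟨h1, h⟩
  have hgood : IntegrableOn (pbetaF β) (A ∩ g ⁻¹' Set.Icc s (s + a)) :=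
    hpint.mono_set fun _ h => h.1.1
  have hbadi : IntegrableOn (pbetaF β) (simplexSet (n + 1) \ A) :=
    hpint.mono_set Set.sdiff_subset
  calc _ ≤ ∫ lam in (A ∩ g ⁻¹' Set.Icc s (s + a)) ∪ (simplexSet (n + 1) \ A), pbetaF β lam :=
        setIntegral_mono_set (hgood.union hbadi)
          (Filter.Eventually.of_forall fun _ => (Real.exp_pos _).le) hsub.eventuallyLE
    _ = (∫ lam in A ∩ g ⁻¹' Set.Icc s (s + a), pbetaF β lam) +
        ∫ lam in simplexSet (n + 1) \ A, pbetaF β lam :=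
        setIntegral_union (Set.disjoint_left.mpr fun _ h h' => h'.2 h.1) (hΔ.diff hAm) hgood hbadi
    _ ≤ N ^ ε * a * M + Real.exp (-φctrl (n + 1)) * M :=
        add_le_add (hwin.trans (mul_le_mul_of_nonneg_right hcoef hM0)) hbad
    _ = _ := by ring
end
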